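/- Let K be a field of characteristic zero and X a rank-two locally nilpotent K-derivation of K[x,y,z] with X(x) = 0. Then for every coordinate system x1,y1,z1 of K[x,y,z] with X(x1) = 0, one has K[x] = K[x1]. -/

import Mathlib

noncomputable section

variable (K : Type) [Field K] [CharZero K]

abbrev PolyR (K : Type) [Field K] : Type := MvPolynomial (Fin 3) K

/-- A derivation is locally nilpotent if every element is killed by some iterate. -/
def LND (X : Derivation K (PolyR K) (PolyR K)) : Prop :=
  ∀ a : PolyR K, ∃ n : ℕ, 0 < n ∧ (⇑X)^[n] a = 0

/-- `X` is irreducible: every common divisor of `X x, X y, X z` is a unit. -/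
def IrredDer (X : Derivation K (PolyR K) (PolyR K)) : Prop :=
  ∀ d : PolyR K, (∀ i : Fin 3, d ∣ X (MvPolynomial.X i)) → IsUnit d

def IsCoord (f : PolyR K) : Prop :=
  ∃ g h : PolyR K, Algebra.adjoin K {f, g, h} = ⊤

def IsCoordSys (u v w : PolyR K) : Prop := Algebra.adjoin K {u, v, w} = ⊤

def IsSysOfCoords2 (u v : PolyR K) : Prop :=
  ∃ w : PolyR K, Algebra.adjoin K {u, v, w} = ⊤

/-- The corank of a derivation: the largest length of a system of coordinates in the kernel. -/
def corank (X : Derivation K (PolyR K) (PolyR K)) : ℕ :=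
  sSup {r : ℕ | ∃ l : List (PolyR K), l.length = r ∧ (∀ f ∈ l, X f = 0) ∧
    ∃ m : List (PolyR K), (l ++ m).length = 3 ∧
      Algebra.adjoin K {a : PolyR K | a ∈ l ++ m} = ⊤}

def rankD (X : Derivation K (PolyR K) (PolyR K)) : ℕ := 3 - corank K X

def IsLocalSlice (X : Derivation K (PolyR K) (PolyR K)) (s : PolyR K) : Prop :=
  X s ≠ 0 ∧ X (X s) = 0

def IsMinLocalSlice (X : Derivation K (PolyR K) (PolyR K)) (s : PolyR K) : Prop :=
  IsLocalSlice K X s ∧ ∀ v : PolyR K, IsLocalSlice K X v → X v ∣ X s →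
    ∃ μ : (PolyR K)ˣ, X v = (μ : PolyR K) * X s

/-- `c` generates the plinth ideal `S^X = {X a : X² a = 0}` as an ideal of the constants. -/
def IsPlinthGen (X : Derivation K (PolyR K) (PolyR K)) (c : PolyR K) : Prop :=
  {d : PolyR K | ∃ a : PolyR K, X a = d ∧ X (X a) = 0} =
    {d : PolyR K | ∃ r : PolyR K, X r = 0 ∧ d = r * c}

/-- `X` is triangulable: triangular in some coordinate system. -/
def Triangulable (X : Derivation K (PolyR K) (PolyR K)) : Prop :=
  ∃ u v w : PolyR K, IsCoordSys K u v w ∧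
    X u ∈ (⊥ : Subalgebra K (PolyR K)) ∧
    X v ∈ Algebra.adjoin K {u} ∧
    X w ∈ Algebra.adjoin K {u, v}

/-- Evaluation of `Q ∈ K[u][T]` at `T = t`, with coefficients evaluated at `u`. -/
def ev2 (u t : PolyR K) (Q : Polynomial (Polynomial K)) : PolyR K :=
  Polynomial.eval₂ (Polynomial.aeval u).toRingHom t Q

/-- The Jacobian derivation `Jac(f,g,·)` applied to `h`. -/
def jacDet (f g h : PolyR K) : PolyR K :=
  Matrix.det !![MvPolynomial.pderiv 0 f, MvPolynomial.pderiv 1 f, MvPolynomial.pderiv 2 f;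
    MvPolynomial.pderiv 0 g, MvPolynomial.pderiv 1 g, MvPolynomial.pderiv 2 g;
    MvPolynomial.pderiv 0 h, MvPolynomial.pderiv 1 h, MvPolynomial.pderiv 2 h]
/-- local nilpotency for a general derivation -/
def IsLN {R B : Type*} [CommRing R] [CommRing B] [Algebra R B] (D : Derivation R B B) : Prop :=
  ∀ a : B, ∃ n : ℕ, (⇑D)^[n] a = 0

section basics
variable {R B : Type*} [CommRing R] [CommRing B] [Algebra R B] (D : Derivation R B B)

lemma iter_zero (n : ℕ) : (⇑D)^[n] 0 = 0 := iterate_map_zero D n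

lemma iter_zero_of_le {a : B} {n m : ℕ} (h : n ≤ m) (ha : (⇑D)^[n] a = 0) : (⇑D)^[m] a = 0 := by
  obtain ⟨k, rfl⟩ := Nat.exists_eq_add_of_le h
  rw [add_comm, Function.iterate_add_apply, ha, iter_zero]

lemma iter_mul_eq (N : ℕ) : ∀ (n m : ℕ) (a b : B), n + m = N → (⇑D)^[n+1] a = 0 →
    (⇑D)^[m+1] b = 0 → (⇑D)^[N] (a * b) = (N.choose n : B) * ((⇑D)^[n] a * (⇑D)^[m] b) := by
  induction N with
  | zero =>
    intro n m a b h _ _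
    obtain ⟨rfl, rfl⟩ : n = 0 ∧ m = 0 := by omega
    simp
  | succ N ih =>
    intro n m a b h ha hb
    rw [Function.iterate_succ_apply, Derivation.leibniz, iterate_map_add, smul_eq_mul, smul_eq_mul]
    rcases n with _ | n
    · have ha' : D a = 0 := ha
      obtain rfl : m = N + 1 := by omega
      rw [ha', mul_zero, iter_zero, ih 0 N a (D b) (by omega) ha hb]
      simp
    · rcases m with _ | m
      · have hb' : D b = 0 := hb
        obtain rfl : n = N := by omega
        rw [hb', mul_zero, iter_zero, mul_comm b, ih n 0 (D a) b (by omega) ha hb]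
        simp
      · rw [ih (n+1) m a (D b) (by omega) ha hb, mul_comm b, ih n (m+1) (D a) b (by omega) ha hb,
          Nat.choose_succ_succ]
        simp only [← Function.iterate_succ_apply, Nat.cast_add]
        ring

lemma iter_mul_zero {n m : ℕ} {a b : B} (ha : (⇑D)^[n] a = 0) (hb : (⇑D)^[m] b = 0) :
    (⇑D)^[n+m] (a * b) = 0 := by
  rw [iter_mul_eq D (n+m) n m a b rfl (iter_zero_of_le D (Nat.le_succ _) ha)
    (iter_zero_of_le D (Nat.le_succ _) hb), ha]
  simp

lemma exists_last (hD : IsLN D) {a : B} (ha : a ≠ 0) :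
    ∃ n, (⇑D)^[n] a ≠ 0 ∧ (⇑D)^[n+1] a = 0 := by
  classical
  have h := hD a
  have hpos : Nat.find h ≠ 0 := by
    intro h0
    have := Nat.find_spec h
    rw [h0] at this
    exact ha this
  obtain ⟨k, hk⟩ := Nat.exists_eq_succ_of_ne_zero hpos
  refine ⟨k, Nat.find_min h (by omega), ?_⟩
  have := Nat.find_spec h
  rwa [hk] at this

/-- kernels of locally nilpotent derivations are factorially closed -/
lemma fact_closed [IsDomain B] [CharZero B] (hD : IsLN D) {a b : B} (hab : a * b ≠ 0)
    (h : D (a * b) = 0) : D a = 0 := by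
  obtain ⟨n, hn, hn'⟩ := exists_last D hD (left_ne_zero_of_mul hab)
  obtain ⟨m, hm, hm'⟩ := exists_last D hD (right_ne_zero_of_mul hab)
  rcases n with _ | n
  · exact hn'
  · exfalso
    have h1 := iter_mul_eq D (n+1+m) (n+1) m a b rfl hn' hm'
    have h2 : (⇑D)^[n+1+m] (a * b) = 0 := iter_zero_of_le D (n := 1) (by omega) h
    rw [h2] at h1
    have h3 : ((n+1+m).choose (n+1) : B) ≠ 0 := by
      exact_mod_cast (Nat.choose_pos (by omega)).ne'
    exact mul_ne_zero h3 (mul_ne_zero hn hm) h1.symm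

lemma exists_local_slice (hD : IsLN D) (h0 : D ≠ 0) : ∃ t, D t ≠ 0 ∧ D (D t) = 0 := by
  have : ∃ a, D a ≠ 0 := by
    by_contra hh
    push Not at hh
    exact h0 (Derivation.ext hh)
  obtain ⟨a, ha⟩ := this
  obtain ⟨n, h1, h2⟩ := exists_last D hD ha
  refine ⟨(⇑D)^[n] a, ?_, ?_⟩
  · rwa [← Function.iterate_succ_apply' (⇑D), Function.iterate_succ_apply]
  · rwa [← Function.iterate_succ_apply' (⇑D), ← Function.iterate_succ_apply' (⇑D),
      Function.iterate_succ_apply]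

/-- a factor of a locally nilpotent derivation is locally nilpotent -/
lemma isLN_of_smul [IsDomain B] [CharZero B] (c : B) (h0 : c • D ≠ 0) (hD : IsLN (c • D)) :
    IsLN D := by
  obtain ⟨t, ht, ht'⟩ := exists_local_slice _ hD h0
  have hc0 : c ≠ 0 := by rintro rfl; simp at h0
  have hc : (c • D) c = 0 := by
    have e : (c • D) t = c * D t := rfl
    rw [e] at ht ht'
    exact fact_closed _ hD ht ht'
  have hc' : D c = 0 := by
    have e : (c • D) c = c * D c := rfl
    rw [e] at hc
    exact (mul_eq_zero.1 hc).resolve_left hc0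
  have hpow : ∀ n a, (⇑(c • D))^[n] a = c ^ n * (⇑D)^[n] a := by
    intro n
    induction n with
    | zero => simp
    | succ n ih =>
      intro a
      rw [Function.iterate_succ_apply', ih, Function.iterate_succ_apply']
      have e : ∀ t, (c • D) t = c * D t := fun _ => rfl
      rw [e, Derivation.leibniz, Derivation.leibniz_pow, hc']
      simp [pow_succ]; ring
  intro a
  obtain ⟨n, hn⟩ := hD a
  rw [hpow] at hn
  exact ⟨n, (mul_eq_zero.1 hn).resolve_left (pow_ne_zero _ hc0)⟩

/-- local nilpotency can be tested on generators -/
lemma isLN_of_adjoin (s : Set B) (hs : Algebra.adjoin R s = ⊤)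
    (h : ∀ a ∈ s, ∃ n : ℕ, (⇑D)^[n] a = 0) : IsLN D := by
  intro a
  have ha : a ∈ Algebra.adjoin R s := by rw [hs]; trivial
  induction ha using Algebra.adjoin_induction with
  | mem x hx => exact h x hx
  | algebraMap r => exact ⟨1, by simp⟩
  | add x y _ _ hx hy =>
    obtain ⟨n, hn⟩ := hx
    obtain ⟨m, hm⟩ := hy
    refine ⟨n + m, ?_⟩
    rw [iterate_map_add, iter_zero_of_le D (by omega) hn, iter_zero_of_le D (by omega) hm, add_zero]
  | mul x y _ _ hx hy =>
    obtain ⟨n, hn⟩ := hx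
    obtain ⟨m, hm⟩ := hy
    exact ⟨n + m, iter_mul_zero D hn hm⟩

/-- a derivation vanishing on a subalgebra over which everything is algebraic is zero -/
lemma der_zero_of_algebraic [IsDomain B] [CharZero B] (S : Subalgebra R B)
    (hS : ∀ a ∈ S, D a = 0) (halg : Algebra.IsAlgebraic S B) : D = 0 := by
  let D' : Derivation S B B := Derivation.mk'
    { toFun := D
      map_add' := fun a b => map_add D a b
      map_smul' := fun r a => by
        rw [Algebra.smul_def, Derivation.leibniz]
        have : D (algebraMap S B r) = 0 := hS _ r.2
        rw [this]
        simp [Algebra.smul_def] } (fun a b => D.leibniz a b)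
  have e : ∀ a, D' a = D a := fun _ => rfl
  ext b
  by_contra hb
  have key : ∀ n (P : Polynomial S), P.natDegree ≤ n → P ≠ 0 → Polynomial.aeval b P ≠ 0 := by
    intro n
    induction n with
    | zero =>
      intro P hP hP0 h
      rw [Polynomial.eq_C_of_natDegree_le_zero hP] at h hP0
      simp at h hP0
      exact hP0 h
    | succ n ih =>
      intro P hP hP0 h
      by_cases hd : P.natDegree = 0
      · exact ih P (by omega) hP0 h
      have h1 := D'.map_aeval P b
      rw [h, map_zero, e, smul_eq_mul] at h1
      have h2 := (mul_eq_zero.1 h1.symm).resolve_right hb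
      refine ih (Polynomial.derivative P) ?_ ?_ h2
      · have := Polynomial.natDegree_derivative_lt hd
        omega
      · intro h3
        have : CharZero S := ⟨fun a b hab => by
          have := congrArg (algebraMap S B) hab
          simpa using this⟩
        exact hd (Polynomial.derivative_eq_zero.1 h3)
  obtain ⟨P, hP, hP'⟩ := halg.isAlgebraic b
  exact key _ P le_rfl hP hP'

end basics

section dim
open Polynomial in
lemma exists_rel_of_biv {R B : Type*} [CommRing R] [CommRing B] [IsDomain B] [Algebra R B]
    (f g : B) (hf : f ≠ 0) : ∀ (n : ℕ) (Q : Polynomial (Polynomial R)), Q.natDegree ≤ n → Q ≠ 0 →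
      aevalAeval g f Q = 0 → ∃ p : Polynomial R, p ≠ 0 ∧ f ∣ aeval g p := by
  intro n
  induction n with
  | zero =>
    intro Q hQ hQ0 h
    rw [Polynomial.eq_C_of_natDegree_le_zero hQ] at h hQ0
    rw [aevalAeval_C] at h
    exact ⟨Q.coeff 0, by simpa using hQ0, by rw [h]; exact dvd_zero _⟩
  | succ n ih =>
    intro Q hQ hQ0 h
    rw [← Polynomial.divX_mul_X_add Q, map_add, map_mul, aevalAeval_C, aevalAeval_Y] at h
    by_cases h0 : Q.coeff 0 = 0
    · rw [h0, map_zero, add_zero] at h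
      refine ih Q.divX ?_ ?_ ((mul_eq_zero.1 h).resolve_right hf)
      · rw [Polynomial.natDegree_divX_eq_natDegree_tsub_one]; omega
      · intro h1
        apply hQ0
        rw [← Polynomial.divX_mul_X_add Q, h0, h1]; simp
    · refine ⟨Q.coeff 0, h0, ⟨- aevalAeval g f Q.divX, ?_⟩⟩
      linear_combination h

lemma exists_rel {R B : Type*} [CommRing R] [CommRing B] [IsDomain B] [Algebra R B]
    (f g : B) (hf : f ≠ 0) (h : ¬ AlgebraicIndependent R ![f, g]) :
    ∃ p : Polynomial R, p ≠ 0 ∧ f ∣ Polynomial.aeval g p := by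
  rw [algebraicIndependent_iff] at h
  push Not at h
  obtain ⟨P, hP, hP0⟩ := h
  let e : MvPolynomial (Fin 2) R →ₐ[R] Polynomial (Polynomial R) :=
    MvPolynomial.aeval ![Polynomial.X, Polynomial.C Polynomial.X]
  let e' : Polynomial (Polynomial R) →ₐ[R] MvPolynomial (Fin 2) R :=
    Polynomial.aevalAeval (MvPolynomial.X 1) (MvPolynomial.X 0)
  have he : e'.comp e = AlgHom.id R _ := by
    ext i; fin_cases i <;> simp [e, e']
  have he2 : (Polynomial.aevalAeval g f).comp e = MvPolynomial.aeval ![f, g] := by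
    apply MvPolynomial.algHom_ext
    intro i; fin_cases i <;> simp [e]
  refine exists_rel_of_biv f g hf _ (e P) le_rfl ?_ ?_
  · intro h0
    apply hP0
    have := DFunLike.congr_fun he P
    simp only [AlgHom.comp_apply, h0, map_zero, AlgHom.id_apply] at this
    exact this.symm
  · have := DFunLike.congr_fun he2 P
    rw [hP] at this
    exact this

variable {R : Type} [CommRing R] [IsDomain R] [CharZero R]

lemma not_algInd (D : Derivation R (MvPolynomial (Fin 2) R) (MvPolynomial (Fin 2) R)) (h0 : D ≠ 0)
    {f g : MvPolynomial (Fin 2) R} (hf : D f = 0) (hg : D g = 0) :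
    ¬ AlgebraicIndependent R ![f, g] := by
  intro h
  have hb := h.isTranscendenceBasis_of_trdeg_le_of_finite
    (by rw [MvPolynomial.trdeg_of_isDomain]; simp)
  apply h0
  refine der_zero_of_algebraic D _ ?_ hb.isAlgebraic
  intro a ha
  refine Derivation.eqOn_adjoin (D2 := 0) ?_ ha
  rintro _ ⟨i, rfl⟩
  fin_cases i <;> simp [hf, hg]

/-- structure of the kernel -/
lemma kernel_gen [UniqueFactorizationMonoid R]
    (D : Derivation R (MvPolynomial (Fin 2) R) (MvPolynomial (Fin 2) R)) (h0 : D ≠ 0)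
    (hD : IsLN D) (w : MvPolynomial (Fin 2) R) (hw : D w = 0)
    (hw' : w ∉ Set.range (MvPolynomial.C (σ := Fin 2) (R := R))) :
    ∃ f, Irreducible f ∧ MvPolynomial.constantCoeff f = 0 ∧ D f = 0 ∧
      ∀ g, D g = 0 → ∃ q : Polynomial R, g = Polynomial.aeval f q := by
  have hDC : ∀ r, D (MvPolynomial.C r) = 0 := fun r => D.map_algebraMap r
  set w' := w - MvPolynomial.C (MvPolynomial.constantCoeff w) with hw'def
  have hw0 : w' ≠ 0 := fun h => hw' ⟨_, (sub_eq_zero.1 h).symm⟩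
  have hDw : D w' = 0 := by rw [map_sub, hw, hDC, sub_zero]
  have hcw : MvPolynomial.constantCoeff w' = 0 := by simp [hw'def]
  have hex : ∃ f, Irreducible f ∧ MvPolynomial.constantCoeff f = 0 ∧ f ∣ w' := by
    clear_value w'
    clear hDw hw'def
    revert hw0 hcw
    induction w' using WfDvdMonoid.induction_on_irreducible with
    | zero => intro h _; exact absurd rfl h
    | unit u hu =>
      intro _ h
      exact absurd h (hu.map MvPolynomial.constantCoeff).ne_zero
    | mul a i ha hi ih =>
      intro _ h
      rw [map_mul] at h
      rcases mul_eq_zero.1 h with h | h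
      · exact ⟨i, hi, h, dvd_mul_right _ _⟩
      · obtain ⟨f, h1, h2, h3⟩ := ih ha h
        exact ⟨f, h1, h2, h3.mul_left _⟩
  obtain ⟨f, hfi, hfc, ⟨v, hv⟩⟩ := hex
  have hDf : D f = 0 := by
    rw [hv] at hw0 hDw
    exact fact_closed D hD hw0 hDw
  have hfp : Prime f := hfi.prime
  have hf0 : f ≠ 0 := hfi.ne_zero
  have hfdeg : 0 < f.totalDegree := by
    rw [Nat.pos_iff_ne_zero]
    intro h
    rw [MvPolynomial.totalDegree_eq_zero_iff_eq_C] at h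
    apply hf0
    rw [h, ← MvPolynomial.constantCoeff_eq, hfc, map_zero]
  refine ⟨f, hfi, hfc, hDf, ?_⟩
  suffices ∀ n g, g.totalDegree ≤ n → D g = 0 → ∃ q : Polynomial R, g = Polynomial.aeval f q from
    fun g hg => this _ g le_rfl hg
  intro n
  induction n using Nat.strong_induction_on with
  | _ n ih =>
  intro g hgn hg
  obtain ⟨p, hp0, hp⟩ := exists_rel f g hf0 (not_algInd D h0 hDf hg)
  obtain ⟨r, hr, hr'⟩ := Polynomial.exists_eq_pow_rootMultiplicity_mul_and_not_dvd p hp0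
    (MvPolynomial.constantCoeff g)
  have hr0 : ¬ f ∣ Polynomial.aeval g r := by
    intro hd
    apply hr'
    rw [Polynomial.dvd_iff_isRoot, Polynomial.IsRoot.def]
    have h1 := map_dvd (MvPolynomial.constantCoeff) hd
    rw [hfc, zero_dvd_iff] at h1
    rw [Polynomial.aeval_def, Polynomial.hom_eval₂] at h1
    have : (MvPolynomial.constantCoeff (σ := Fin 2) (R := R)).comp (algebraMap R _) = RingHom.id R := by
      ext; simp
    rw [this] at h1
    rw [Polynomial.eval]; exact h1
  have hd : f ∣ g - MvPolynomial.C (MvPolynomial.constantCoeff g) := by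
    rw [hr, map_mul, map_pow] at hp
    have := hfp.dvd_of_dvd_pow ((hfp.dvd_or_dvd hp).resolve_right hr0)
    simpa using this
  obtain ⟨g', hg'⟩ := hd
  by_cases hz : g' = 0
  · refine ⟨Polynomial.C (MvPolynomial.constantCoeff g), ?_⟩
    rw [hz, mul_zero, sub_eq_zero] at hg'
    rw [Polynomial.aeval_C]; exact hg'
  have hDg' : D g' = 0 := by
    have := congrArg D hg'
    rw [map_sub, hg, hDC, Derivation.leibniz, hDf] at this
    rw [sub_zero, smul_zero, add_zero, smul_eq_mul] at this
    exact (mul_eq_zero.1 this.symm).resolve_left hf0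
  have hdeg : g'.totalDegree < n := by
    have h1 := MvPolynomial.totalDegree_mul_of_isDomain hf0 hz
    have h2 := MvPolynomial.totalDegree_sub g (MvPolynomial.C (MvPolynomial.constantCoeff g))
    rw [hg', MvPolynomial.totalDegree_C] at h2
    have : g.totalDegree ⊔ 0 = g.totalDegree := by simp
    omega
  obtain ⟨q, hq⟩ := ih _ hdeg g' le_rfl hDg'
  refine ⟨Polynomial.C (MvPolynomial.constantCoeff g) + Polynomial.X * q, ?_⟩
  rw [map_add, map_mul, ← hq, Polynomial.aeval_X, ← hg']
  simp
end dim

section slice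
open MvPolynomial

lemma quot_alg {F : Type} [Field F] [CharZero F]
    (D : Derivation F (MvPolynomial (Fin 2) F) (MvPolynomial (Fin 2) F))
    (p : MvPolynomial (Fin 2) F) (hp : Irreducible p) (hDp : D p = 0) (hnd : ∃ b, ¬ p ∣ D b)
    (t : MvPolynomial (Fin 2) F) (ht : p ∣ D t) :
    ∃ q : Polynomial F, q ≠ 0 ∧ p ∣ Polynomial.aeval t q := by
  by_contra hcon
  push Not at hcon
  let I : Ideal (MvPolynomial (Fin 2) F) := Ideal.span {p}
  have hmem : ∀ a, a ∈ I ↔ p ∣ a := fun a => Ideal.mem_span_singleton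
  have hI : I.IsPrime := (Ideal.span_singleton_prime hp.ne_zero).2 hp.prime
  let C' := MvPolynomial (Fin 2) F ⧸ I
  have : CharZero C' := charZero_of_injective_algebraMap (algebraMap F C').injective
  let m : MvPolynomial (Fin 2) F →ₐ[F] C' := Ideal.Quotient.mkₐ F I
  have hm0 : ∀ a, m a = 0 ↔ p ∣ a := fun a => by
    rw [← hmem]; exact Ideal.Quotient.eq_zero_iff_mem
  have hms : Function.Surjective m := Ideal.Quotient.mkₐ_surjective F I
  let H : C' →ₗ[F] C' := Submodule.liftQ (I.restrictScalars F) (m.toLinearMap ∘ₗ (D : _ →ₗ[F] _)) (by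
    intro a ha
    obtain ⟨b, rfl⟩ := (hmem a).1 ha
    change m (D (p * b)) = 0
    rw [hm0, Derivation.leibniz, hDp]
    simp)
  have hH : ∀ a, H (m a) = m (D a) := fun a => rfl
  let E : Derivation F C' C' := Derivation.mk' H (by
    intro a b
    obtain ⟨a, rfl⟩ := hms a
    obtain ⟨b, rfl⟩ := hms b
    rw [← map_mul, hH, hH, hH, Derivation.leibniz]
    simp)
  have hE : ∀ a, E (m a) = m (D a) := fun a => rfl
  have htr : Algebra.trdeg F C' ≤ 1 := by
    by_contra hlt
    rw [not_le] at hlt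
    have h2 : (2 : Cardinal) ≤ Algebra.trdeg F C' := by
      have := Order.succ_le_of_lt hlt
      have h3 := Cardinal.succ_natCast 1
      rw [Nat.cast_one, one_add_one_eq_two] at h3
      rwa [h3] at this
    let x : Fin 2 → C' := fun i => m (X i)
    have hx : Algebra.adjoin F (Set.range x) = ⊤ := by
      have h1 : Set.range x = m '' (Set.range X) := by
        rw [← Set.range_comp]; rfl
      rw [h1, ← AlgHom.map_adjoin, MvPolynomial.adjoin_range_X, Algebra.map_top]
      exact (AlgHom.range_eq_top m).2 hms
    have : Algebra.IsAlgebraic (Algebra.adjoin F (Set.range x)) C' := by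
      constructor
      intro a
      have ha : a ∈ Algebra.adjoin F (Set.range x) := by rw [hx]; trivial
      exact isAlgebraic_algebraMap (⟨a, ha⟩ : Algebra.adjoin F (Set.range x))
    have hb := Algebra.IsAlgebraic.isTranscendenceBasis_of_le_trdeg_of_finite F x (by simpa using h2)
    have h3 := (algebraicIndependent_iff.1 hb.1) p (by
      have : (aeval x : MvPolynomial (Fin 2) F →ₐ[F] C') = m := by
        apply MvPolynomial.algHom_ext
        intro i; simp [x]
      rw [this, hm0])
    exact hp.ne_zero h3
  have hti : AlgebraicIndependent F ![m t] := by
    rw [algebraicIndependent_iff_transcendental, transcendental_iff]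
    intro q hq
    by_contra hq0
    apply hcon q hq0
    rw [← hm0, ← hq, Polynomial.aeval_algHom_apply]
  have hb := hti.isTranscendenceBasis_of_trdeg_le_of_finite (by simpa using htr)
  have hE0 : E = 0 := by
    refine der_zero_of_algebraic E _ ?_ hb.isAlgebraic
    intro a ha
    refine Derivation.eqOn_adjoin (D2 := 0) ?_ ha
    rintro _ ⟨i, rfl⟩
    fin_cases i
    change E (m t) = 0
    rw [hE, hm0]
    exact ht
  obtain ⟨b, hb⟩ := hnd
  apply hb
  rw [← hm0, ← hE, hE0]
  rfl

lemma dvd_der {R : Type} [CommRing R]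
    (D : Derivation R (MvPolynomial (Fin 2) R) (MvPolynomial (Fin 2) R))
    (d : MvPolynomial (Fin 2) R) (h : ∀ i, d ∣ D (X i)) (a) : d ∣ D a := by
  induction a using MvPolynomial.induction_on with
  | C r => rw [show D (C r) = 0 from D.map_algebraMap r]; exact dvd_zero _
  | add p q hp hq => rw [map_add]; exact dvd_add hp hq
  | mul_X p i hp =>
    rw [Derivation.leibniz]
    exact dvd_add ((h i).mul_left _) (hp.mul_left _)

lemma slice_closed {F : Type} [Field F] [CharZero F] [IsAlgClosed F]
    (D : Derivation F (MvPolynomial (Fin 2) F) (MvPolynomial (Fin 2) F)) (hD : IsLN D)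
    (hirr : ∀ d, (∀ i, d ∣ D (X i)) → IsUnit d) : ∃ s, D s = 1 := by
  have hD0 : D ≠ 0 := by
    rintro rfl
    have := hirr 0 (by simp)
    exact not_isUnit_zero this
  obtain ⟨t, ht, ht'⟩ := exists_local_slice D hD hD0
  have key : ∀ n t, (D t).totalDegree ≤ n → D t ≠ 0 → D (D t) = 0 → ∃ s, D s = 1 := by
    intro n
    induction n using Nat.strong_induction_on with
    | _ n ih =>
    intro t htn ht ht'
    by_cases hu : IsUnit (D t)
    · obtain ⟨c, hc⟩ := MvPolynomial.isUnit_iff_eq_C_of_isReduced.1 hu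
      refine ⟨C c⁻¹ * t, ?_⟩
      rw [Derivation.leibniz, show D (C c⁻¹) = 0 from D.map_algebraMap _, hc.2, smul_zero, add_zero,
        smul_eq_mul, ← C_mul, inv_mul_cancel₀ hc.1.ne_zero, C_1]
    · obtain ⟨p, hp, ⟨h', hh'⟩⟩ := WfDvdMonoid.exists_irreducible_factor hu ht
      have hDp : D p = 0 := by
        rw [hh'] at ht ht'
        exact fact_closed D hD ht ht'
      have hnd : ∃ b, ¬ p ∣ D b := by
        by_contra hh
        push Not at hh
        exact hp.not_isUnit (hirr p fun i => hh _)
      obtain ⟨q, hq0, hq⟩ := quot_alg D p hp hDp hnd t ⟨h', hh'⟩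
      have hroot : ∃ τ : F, p ∣ t - C τ := by
        clear ih
        have : ∀ k (q : Polynomial F), q.natDegree ≤ k → q ≠ 0 → p ∣ Polynomial.aeval t q →
            ∃ τ : F, p ∣ t - C τ := by
          intro k
          induction k with
          | zero =>
            intro q hqk hq0 hq
            rw [Polynomial.eq_C_of_natDegree_le_zero hqk] at hq hq0
            exfalso
            apply hp.not_isUnit
            refine isUnit_of_dvd_unit hq ?_
            rw [Polynomial.aeval_C]
            exact (IsUnit.mk0 _ (by simpa using hq0)).map _
          | succ k ihk =>
            intro q hqk hq0 hq
            by_cases hdeg : q.natDegree = 0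
            · exact ihk q (by omega) hq0 hq
            obtain ⟨τ, hτ⟩ := IsAlgClosed.exists_root q (by
              intro h; exact hdeg (Polynomial.natDegree_eq_of_degree_eq_some h))
            obtain ⟨r, hr⟩ := Polynomial.dvd_iff_isRoot.2 hτ
            have hr0 : r ≠ 0 := by rintro rfl; simp at hr; exact hq0 hr
            rw [hr, map_mul] at hq
            rcases hp.prime.dvd_or_dvd hq with h | h
            · exact ⟨τ, by simpa using h⟩
            · refine ihk r ?_ hr0 h
              have := congrArg Polynomial.natDegree hr
              rw [Polynomial.natDegree_mul (Polynomial.X_sub_C_ne_zero _) hr0,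
                Polynomial.natDegree_X_sub_C] at this
              omega
        exact this _ q le_rfl hq0 hq
      obtain ⟨τ, ⟨t', htt'⟩⟩ := hroot
      have hDt' : D t' = h' := by
        have := congrArg D htt'
        rw [map_sub, show D (C τ) = 0 from D.map_algebraMap _, Derivation.leibniz, hDp, hh',
          sub_zero, smul_zero, add_zero, smul_eq_mul] at this
        exact (mul_left_cancel₀ hp.ne_zero this).symm
      have hh0 : h' ≠ 0 := by rintro rfl; rw [mul_zero] at hh'; exact ht hh'
      have hpdeg : 0 < p.totalDegree := by
        rw [Nat.pos_iff_ne_zero]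
        intro h
        rw [MvPolynomial.totalDegree_eq_zero_iff_eq_C] at h
        apply hp.not_isUnit
        rw [h]
        refine (IsUnit.mk0 _ ?_).map _
        intro h0
        rw [h0, C_0] at h
        exact hp.ne_zero h
      have hdeg := MvPolynomial.totalDegree_mul_of_isDomain hp.ne_zero hh0
      rw [← hh'] at hdeg
      refine ih h'.totalDegree (by omega) t' (by rw [hDt']) (by rw [hDt']; exact hh0) ?_
      rw [hDt']
      rw [hh', Derivation.leibniz, hDp, smul_zero, add_zero, smul_eq_mul] at ht'
      exact (mul_eq_zero.1 ht').resolve_left hp.ne_zero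
  exact key _ t le_rfl ht ht'
end slice

section descent
open MvPolynomial

/-- Apply a linear map to all coefficients. -/
def Lam {R F : Type} [CommRing R] [Field F] [Algebra R F] (l : F →ₗ[R] F)
    (P : MvPolynomial (Fin 2) F) : MvPolynomial (Fin 2) F :=
  AddMonoidAlgebra.map l.toAddMonoidHom P

lemma coeff_Lam {R F : Type} [CommRing R] [Field F] [Algebra R F]
    (l : F →ₗ[R] F) (P : MvPolynomial (Fin 2) F) (m) :
    coeff m (Lam l P) = l (coeff m P) := by
  simp [Lam]

lemma exists_lambda {R F : Type} [CommRing R] [IsDomain R] [Field F] [Algebra R F]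
    [Algebra (FractionRing R) F] [IsScalarTower R (FractionRing R) F]
    (S : Finset F) (c : F) (hc : c ≠ 0) :
    ∃ l : F →ₗ[R] F, l c ≠ 0 ∧ ∀ a ∈ S, l a ∈ Set.range (algebraMap R F) := by
  obtain ⟨φ, hφ⟩ : ∃ φ : Module.Dual (FractionRing R) F, φ c ≠ 0 := by
    by_contra h
    push Not at h
    exact hc ((Module.forall_dual_apply_eq_zero_iff (FractionRing R) c).1 h)
  classical
  obtain ⟨b, hb⟩ := IsLocalization.exist_integer_multiples_of_finset
    (nonZeroDivisors R) (S.image φ)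
  refine ⟨(b : R) • ((Algebra.linearMap (FractionRing R) F ∘ₗ φ).restrictScalars R), ?_, ?_⟩
  · simp only [LinearMap.smul_apply, LinearMap.restrictScalars_apply, LinearMap.comp_apply,
      Algebra.linearMap_apply]
    rw [Algebra.smul_def, IsScalarTower.algebraMap_apply R (FractionRing R) F, ← map_mul, ne_eq,
      map_eq_zero, mul_eq_zero, not_or]
    refine ⟨?_, hφ⟩
    simp
  · intro a ha
    obtain ⟨r, hr⟩ := hb (φ a) (Finset.mem_image_of_mem _ ha)
    refine ⟨r, ?_⟩
    simp only [LinearMap.smul_apply, LinearMap.restrictScalars_apply, LinearMap.comp_apply,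
      Algebra.linearMap_apply]
    rw [IsScalarTower.algebraMap_apply R (FractionRing R) F, hr, Algebra.smul_def,
      Algebra.smul_def, map_mul, ← IsScalarTower.algebraMap_apply R (FractionRing R) F]

lemma Lam_add {R F : Type} [CommRing R] [Field F] [Algebra R F]
    (l : F →ₗ[R] F) (P Q : MvPolynomial (Fin 2) F) : Lam l (P + Q) = Lam l P + Lam l Q := by
  ext m; simp [coeff_Lam]

lemma Lam_mul {R F : Type} [CommRing R] [Field F] [Algebra R F]
    (l : F →ₗ[R] F) (p : MvPolynomial (Fin 2) R) (P : MvPolynomial (Fin 2) F) :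
    Lam l (map (algebraMap R F) p * P) = map (algebraMap R F) p * Lam l P := by
  ext m
  rw [coeff_Lam, coeff_mul, coeff_mul, map_sum]
  refine Finset.sum_congr rfl fun x _ => ?_
  rw [coeff_map, coeff_Lam, ← Algebra.smul_def, map_smul, Algebra.smul_def]

lemma Lam_C_mul {R F : Type} [CommRing R] [Field F] [Algebra R F]
    (l : F →ₗ[R] F) (a : F) (p : MvPolynomial (Fin 2) R) :
    Lam l (C a * map (algebraMap R F) p) = C (l a) * map (algebraMap R F) p := by
  ext m
  rw [coeff_Lam, coeff_C_mul, coeff_C_mul, coeff_map, mul_comm, ← Algebra.smul_def, map_smul,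
    Algebra.smul_def, mul_comm]

lemma Lam_totalDegree {R F : Type} [CommRing R] [Field F] [Algebra R F]
    (l : F →ₗ[R] F) (P : MvPolynomial (Fin 2) F) :
    (Lam l P).totalDegree ≤ P.totalDegree := by
  refine Finset.sup_mono fun m hm => ?_
  rw [mem_support_iff, coeff_Lam] at hm
  rw [mem_support_iff]
  rintro h
  rw [h, map_zero] at hm
  exact hm rfl

lemma Lam_range {R F : Type} [CommRing R] [Field F] [Algebra R F]
    (l : F →ₗ[R] F) (P : MvPolynomial (Fin 2) F)
    (h : ∀ m ∈ P.support, l (coeff m P) ∈ Set.range (algebraMap R F)) :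
    ∃ Q, map (algebraMap R F) Q = Lam l P := by
  have : Lam l P ∈ Set.range (map (σ := Fin 2) (algebraMap R F)) := by
    rw [mem_range_map_iff_coeffs_subset]
    intro a ha
    rw [Finset.mem_coe, mem_coeffs_iff] at ha
    obtain ⟨m, hm, rfl⟩ := ha
    rw [coeff_Lam]
    apply h
    rw [mem_support_iff, coeff_Lam] at hm
    rw [mem_support_iff]
    rintro h
    rw [h, map_zero] at hm
    exact hm rfl
  exact this

lemma totalDegree_map_inj {R F : Type} [CommRing R] [CommRing F] (j : R →+* F)
    (hinj : Function.Injective j) (p : MvPolynomial (Fin 2) R) :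
    (map j p).totalDegree = p.totalDegree := by
  rw [totalDegree, totalDegree, support_map_of_injective _ hinj]

lemma unit_of_dvd_map {R F : Type} [CommRing R] [IsDomain R] [UniqueFactorizationMonoid R]
    [Field F] [Algebra R F]
    [Algebra (FractionRing R) F] [IsScalarTower R (FractionRing R) F]
    (hinj : Function.Injective (algebraMap R F))
    (u v : MvPolynomial (Fin 2) R) (huv : IsRelPrime u v) (hv : v ≠ 0) (d : MvPolynomial (Fin 2) F)
    (hdu : d ∣ map (algebraMap R F) u) (hdv : d ∣ map (algebraMap R F) v) : IsUnit d := by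
  classical
  obtain ⟨u', hu'⟩ := hdu
  obtain ⟨v', hv'⟩ := hdv
  have hιinj := MvPolynomial.map_injective (σ := Fin 2) _ hinj
  have hιv : map (algebraMap R F) v ≠ 0 := by
    rw [ne_eq, map_eq_zero_iff _ hιinj]; exact hv
  have hd0 : d ≠ 0 := by rintro rfl; rw [zero_mul] at hv'; exact hιv hv'
  have hv'0 : v' ≠ 0 := by rintro rfl; rw [mul_zero] at hv'; exact hιv hv'
  obtain ⟨m, hm⟩ := MvPolynomial.ne_zero_iff.1 hv'0
  obtain ⟨l, hl0, hl⟩ := exists_lambda (R := R)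
    (u'.support.image (fun m => coeff m u') ∪ v'.support.image (fun m => coeff m v')) _ hm
  obtain ⟨u'', hu''⟩ := Lam_range l u' (fun m hm => hl _ (Finset.mem_union_left _
    (Finset.mem_image_of_mem (fun m => coeff m u') hm)))
  obtain ⟨v'', hv''⟩ := Lam_range l v' (fun m hm => hl _ (Finset.mem_union_right _
    (Finset.mem_image_of_mem (fun m => coeff m v') hm)))
  have hv''0 : v'' ≠ 0 := by
    rintro rfl
    rw [map_zero] at hv''
    have := coeff_Lam l v' m
    rw [← hv'', coeff_zero] at this
    exact hl0 this.symm
  have key : u * v'' = v * u'' := by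
    apply hιinj
    rw [map_mul, map_mul, hu'', hv'', ← Lam_mul, ← Lam_mul, hu', hv']
    congr 1
    ring
  have hdvd : v ∣ v'' := huv.symm.dvd_of_dvd_mul_left ⟨u'', key⟩
  obtain ⟨w, hw⟩ := hdvd
  have hw0 : w ≠ 0 := by rintro rfl; simp at hw; exact hv''0 hw
  have e1 : v''.totalDegree = v.totalDegree + w.totalDegree := by
    rw [hw, totalDegree_mul_of_isDomain hv hw0]
  have e2 : (map (algebraMap R F) v).totalDegree = d.totalDegree + v'.totalDegree := by
    rw [hv', totalDegree_mul_of_isDomain hd0 hv'0]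
  have e3 := Lam_totalDegree l v'
  rw [← hv'', totalDegree_map_inj _ hinj] at e3
  rw [totalDegree_map_inj _ hinj] at e2
  have e4 : d.totalDegree = 0 := by omega
  rw [totalDegree_eq_zero_iff_eq_C] at e4
  rw [e4]
  have : coeff 0 d ≠ 0 := by
    intro h; rw [h, map_zero] at e4; exact hd0 e4
  exact (IsUnit.mk0 _ this).map C

lemma local_slice_const {R : Type} [CommRing R] [IsDomain R] [CharZero R]
    [UniqueFactorizationMonoid R]
    (D : Derivation R (MvPolynomial (Fin 2) R) (MvPolynomial (Fin 2) R)) (hD : IsLN D)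
    (hirr : ∀ d, (∀ i, d ∣ D (X i)) → IsUnit d) : ∃ s, ∃ a : R, a ≠ 0 ∧ D s = C a := by
  classical
  let F := AlgebraicClosure (FractionRing R)
  have hinj : Function.Injective (algebraMap R F) := by
    rw [IsScalarTower.algebraMap_eq R (FractionRing R) F]
    exact (algebraMap (FractionRing R) F).injective.comp (IsFractionRing.injective R _)
  have : CharZero (FractionRing R) :=
    charZero_of_injective_algebraMap (IsFractionRing.injective R (FractionRing R))
  have : CharZero F := charZero_of_injective_algebraMap hinj
  let ι := map (σ := Fin 2) (algebraMap R F)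
  have hιinj : Function.Injective ι := MvPolynomial.map_injective (σ := Fin 2) _ hinj
  let D' : Derivation F (MvPolynomial (Fin 2) F) (MvPolynomial (Fin 2) F) :=
    mkDerivation F (fun i => ι (D (X i)))
  have hC : ∀ a : R, D (C a) = 0 := fun a => D.map_algebraMap a
  have hC' : ∀ a : F, D' (C a) = 0 := fun a => D'.map_algebraMap a
  have hDι : ∀ p, D' (ι p) = ι (D p) := by
    intro p
    induction p using MvPolynomial.induction_on with
    | C r => rw [hC, map_zero, show ι (C r) = C (algebraMap R F r) from map_C _ _, hC']
    | add p q hp hq => rw [map_add, map_add, map_add, hp, hq, map_add]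
    | mul_X p i hp =>
      have : D' (X i) = ι (D (X i)) := mkDerivation_X _ _ _
      have hX : ι (X i) = X i := map_X _ _
      rw [map_mul, Derivation.leibniz, Derivation.leibniz, hp, hX, this]
      simp only [smul_eq_mul, map_add, map_mul, hX]
  have hD'iter : ∀ n p, (⇑D')^[n] (ι p) = ι ((⇑D)^[n] p) := by
    intro n
    induction n with
    | zero => intro p; rfl
    | succ n ih => intro p; rw [Function.iterate_succ_apply, Function.iterate_succ_apply, hDι, ih]
  have hD' : IsLN D' := by
    apply isLN_of_adjoin D' _ (MvPolynomial.adjoin_range_X)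
    rintro _ ⟨i, rfl⟩
    obtain ⟨n, hn⟩ := hD (X i)
    refine ⟨n, ?_⟩
    have := hD'iter n (X i)
    rw [hn, map_zero, show ι (X i) = X i from map_X _ _] at this
    exact this
  have hrel : IsRelPrime (D (X 0)) (D (X 1)) := by
    intro d h0 h1
    apply hirr
    intro i
    fin_cases i
    · exact h0
    · exact h1
  have hirr' : ∀ d, (∀ i, d ∣ D' (X i)) → IsUnit d := by
    intro d hd
    have h0 : d ∣ ι (D (X 0)) := by
      have := hd 0; rwa [show D' (X 0) = _ from mkDerivation_X _ _ _] at this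
    have h1 : d ∣ ι (D (X 1)) := by
      have := hd 1; rwa [show D' (X 1) = _ from mkDerivation_X _ _ _] at this
    by_cases hv : D (X 1) = 0
    · by_cases hu : D (X 0) = 0
      · rw [hu, hv] at hrel
        exact absurd (hrel (dvd_refl 0) (dvd_refl 0)) not_isUnit_zero
      · exact unit_of_dvd_map hinj _ _ hrel.symm hu d h1 h0
    · exact unit_of_dvd_map hinj _ _ hrel hv d h0 h1
  obtain ⟨s0, hs0⟩ := slice_closed D' hD' hirr'
  have hcomm : ∀ (l : F →ₗ[R] F) P, Lam l (D' P) = D' (Lam l P) := by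
    intro l P
    induction P using MvPolynomial.induction_on' with
    | add p q hp hq => rw [map_add, Lam_add, Lam_add, map_add, hp, hq]
    | monomial m a =>
      have h1 : monomial m a = C a * ι (monomial m 1) := by
        rw [show ι (monomial m 1) = monomial m (algebraMap R F 1) from map_monomial _ _ _, map_one,
          C_mul_monomial, mul_one]
      rw [h1, Lam_C_mul, Derivation.leibniz, Derivation.leibniz, hC', smul_zero,
        add_zero, smul_eq_mul, hC', smul_zero, add_zero, smul_eq_mul]
      erw [hDι]
      exact Lam_C_mul _ _ _
  obtain ⟨l, hl0, hl⟩ := exists_lambda (R := R) (F := F)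
    (insert 1 (s0.support.image (fun m => coeff m s0))) 1 one_ne_zero
  obtain ⟨s, hs⟩ := Lam_range l s0 (fun m hm => hl _ (Finset.mem_insert_of_mem
    (Finset.mem_image_of_mem (fun m => coeff m s0) hm)))
  obtain ⟨a, ha⟩ := hl 1 (Finset.mem_insert_self _ _)
  refine ⟨s, a, ?_, ?_⟩
  · rintro rfl
    rw [map_zero] at ha
    exact hl0 ha.symm
  · apply hιinj
    rw [← hDι]
    have h1 : ι s = Lam l s0 := hs
    have h2 := Lam_C_mul l 1 (1 : MvPolynomial (Fin 2) R)
    simp only [map_one, mul_one] at h2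
    rw [h1, ← hcomm, hs0, h2, ← ha]
    exact (map_C _ _).symm
end descent

section degree
open MvPolynomial

lemma totalDegree_aeval_aux {R : Type} [CommRing R] [IsDomain R] {σ : Type}
    (f : MvPolynomial σ R) (hf : 0 < f.totalDegree) : ∀ (n : ℕ) (q : Polynomial R),
    q.natDegree ≤ n → q ≠ 0 → Polynomial.aeval f q ≠ 0 ∧
      (Polynomial.aeval f q).totalDegree = q.natDegree * f.totalDegree := by
  intro n
  have hf0 : f ≠ 0 := by rintro rfl; simp at hf
  induction n with
  | zero =>
    intro q hq hq0
    obtain ⟨c, rfl⟩ := Polynomial.natDegree_eq_zero.1 (Nat.le_zero.1 hq)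
    have hc : c ≠ 0 := by rintro rfl; simp at hq0
    rw [Polynomial.aeval_C, Polynomial.natDegree_C, zero_mul]
    exact ⟨by rw [algebraMap_eq]; simpa using hc, totalDegree_C _⟩
  | succ n ih =>
    intro q hq hq0
    by_cases hd : q.natDegree ≤ n
    · exact ih q hd hq0
    have hdd : q.divX.natDegree = n := by rw [Polynomial.natDegree_divX_eq_natDegree_tsub_one]; omega
    have hd0 : q.divX ≠ 0 := by
      intro h
      rw [Polynomial.divX_eq_zero_iff] at h
      rw [h, Polynomial.natDegree_C] at hd
      omega
    obtain ⟨h1, h2⟩ := ih _ hdd.le hd0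
    have h3 : Polynomial.aeval f q = Polynomial.aeval f q.divX * f + C (q.coeff 0) := by
      conv_lhs => rw [← Polynomial.divX_mul_X_add q]
      rw [map_add, map_mul, Polynomial.aeval_X, Polynomial.aeval_C, algebraMap_eq]
    have h4 : (Polynomial.aeval f q.divX * f).totalDegree = (n + 1) * f.totalDegree := by
      rw [totalDegree_mul_of_isDomain h1 hf0, h2, hdd]; ring
    have h5 : 0 < (n + 1) * f.totalDegree := by positivity
    have h6 : (Polynomial.aeval f q).totalDegree = (n + 1) * f.totalDegree := by
      rw [h3, totalDegree_add_eq_left_of_totalDegree_lt, h4]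
      rw [totalDegree_C, h4]; exact h5
    refine ⟨?_, ?_⟩
    · intro h; rw [h, totalDegree_zero] at h6; omega
    · rw [h6]; congr 1; omega

lemma totalDegree_aeval {R : Type} [CommRing R] [IsDomain R] {σ : Type}
    (f : MvPolynomial σ R) (q : Polynomial R) :
    (Polynomial.aeval f q).totalDegree = q.natDegree * f.totalDegree := by
  rcases Nat.eq_zero_or_pos f.totalDegree with h | h
  · rw [h, mul_zero]
    rw [totalDegree_eq_zero_iff_eq_C] at h
    rw [h, ← algebraMap_eq, Polynomial.aeval_algebraMap_apply, algebraMap_eq, totalDegree_C]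
  · by_cases hq : q = 0
    · simp [hq]
    · exact (totalDegree_aeval_aux f h _ q le_rfl hq).2

lemma div_aeval {L : Type} [Field L] {σ : Type} (g : MvPolynomial σ L) (hg : 0 < g.totalDegree)
    (β ε : Polynomial L) (hβ : β ≠ 0) (s : MvPolynomial σ L)
    (h : Polynomial.aeval g β * s = Polynomial.aeval g ε) : ∃ q : Polynomial L, s = Polynomial.aeval g q := by
  refine ⟨ε / β, ?_⟩
  by_contra hne
  have h1 : Polynomial.aeval g β * (s - Polynomial.aeval g (ε / β)) =
      Polynomial.aeval g (ε % β) := by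
    rw [mul_sub, h, ← map_mul, ← map_sub]
    congr 1
    rw [sub_eq_iff_eq_add, add_comm]
    exact (EuclideanDomain.div_add_mod ε β).symm
  have h2 : s - Polynomial.aeval g (ε / β) ≠ 0 := sub_ne_zero.2 hne
  obtain ⟨h3, h4⟩ := totalDegree_aeval_aux g hg _ β le_rfl hβ
  have h5 := totalDegree_mul_of_isDomain h3 h2
  rw [h1, totalDegree_aeval, h4] at h5
  have h6 : ε % β ≠ 0 := by
    intro h; rw [h, map_zero] at h1; exact mul_ne_zero h3 h2 h1
  have h7 : (ε % β).natDegree < β.natDegree :=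
    Polynomial.natDegree_lt_natDegree h6 (EuclideanDomain.mod_lt ε hβ)
  have := Nat.mul_lt_mul_of_pos_right h7 hg
  omega
end degree

section finalstep
open MvPolynomial

lemma slice_of_coprime {R : Type} [CommRing R] [IsDomain R] [IsPrincipalIdealRing R]
    (D : Derivation R (MvPolynomial (Fin 2) R) (MvPolynomial (Fin 2) R))
    (f : MvPolynomial (Fin 2) R) (hf : Irreducible f) (hfc : constantCoeff f = 0) (hDf : D f = 0)
    (hker : ∀ g, D g = 0 → ∃ q : Polynomial R, g = Polynomial.aeval f q)
    (s1 B1 : MvPolynomial (Fin 2) R) (hs1 : D s1 = B1) (hB1 : D B1 = 0)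
    (hcop : ∀ p : R, Irreducible p → ¬ C p ∣ B1) :
    ∀ a : R, a ≠ 0 → ∀ s, D s = C a → ∃ s', D s' = 1 := by
  have hC : ∀ a : R, D (C a) = 0 := fun a => D.map_algebraMap a
  have hfπ : ∀ p : R, Irreducible p → ¬ C p ∣ f := by
    rintro p hp ⟨g, hg⟩
    have hCp : ¬ IsUnit (C p : MvPolynomial (Fin 2) R) := by
      intro h
      have := h.map (constantCoeff (σ := Fin 2) (R := R))
      rw [constantCoeff_C] at this
      exact hp.not_isUnit this
    have hgu : IsUnit g := (hf.isUnit_or_isUnit hg).resolve_left hCp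
    have h1 := hgu.map (constantCoeff (σ := Fin 2) (R := R))
    rw [hg, map_mul, constantCoeff_C] at hfc
    exact mul_ne_zero hp.ne_zero h1.ne_zero hfc
  intro a
  induction a using WfDvdMonoid.induction_on_irreducible with
  | zero => intro h; exact absurd rfl h
  | unit u hu =>
    intro _ s hs
    obtain ⟨v, hv⟩ := hu.exists_right_inv
    refine ⟨C v * s, ?_⟩
    rw [Derivation.leibniz, hC, hs, smul_eq_mul, smul_zero, add_zero, ← C_mul, mul_comm, hv, C_1]
  | mul a p ha hp ih =>
    intro hpa s hs
    have hDe : D (B1 * s - C (p * a) * s1) = 0 := by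
      rw [map_sub, Derivation.leibniz, Derivation.leibniz, hB1, hC, hs, hs1]
      simp only [smul_eq_mul]; ring
    obtain ⟨ε, hε⟩ := hker _ hDe
    obtain ⟨β, hβ⟩ := hker _ hB1
    have hmax : (Ideal.span {p}).IsMaximal := PrincipalIdealRing.isMaximal_of_irreducible hp
    let _ : Field (R ⧸ Ideal.span {p}) := Ideal.Quotient.field _
    let π : R →+* R ⧸ Ideal.span {p} := Ideal.Quotient.mk _
    have hπ : ∀ r, π r = 0 ↔ p ∣ r := fun r => by
      rw [← Ideal.mem_span_singleton]; exact Ideal.Quotient.eq_zero_iff_mem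
    have hmapC : ∀ g : MvPolynomial (Fin 2) R, map π g = 0 ↔ C p ∣ g := fun g =>
      (C_dvd_iff_map_hom_eq_zero π p hπ g).symm
    have hmapae : ∀ q : Polynomial R, map π (Polynomial.aeval f q) =
        Polynomial.aeval (map π f) (q.map π) := by
      intro q
      rw [Polynomial.aeval_def, Polynomial.aeval_def, Polynomial.hom_eval₂, Polynomial.eval₂_map]
      congr 1
      ext r : 1
      simp [algebraMap_eq]
    have hβ0 : β.map π ≠ 0 := by
      intro h
      apply hcop p hp
      rw [← hmapC, hβ, hmapae, h, map_zero]
    have hfdeg : 0 < (map π f).totalDegree := by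
      rw [Nat.pos_iff_ne_zero]
      intro h
      rw [totalDegree_eq_zero_iff_eq_C] at h
      apply hfπ p hp
      rw [← hmapC, h, coeff_map, ← constantCoeff_eq, hfc, map_zero, map_zero]
    have heq : Polynomial.aeval (map π f) (β.map π) * map π s =
        Polynomial.aeval (map π f) (ε.map π) := by
      rw [← hmapae, ← hmapae, ← hβ, ← hε, map_sub, map_mul, map_mul, map_C,
        (hπ (p * a)).2 (Dvd.intro _ rfl)]
      simp
    obtain ⟨qb, hqb⟩ := div_aeval _ hfdeg _ _ hβ0 _ heq
    obtain ⟨q, rfl⟩ := Polynomial.map_surjective π Ideal.Quotient.mk_surjective qb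
    have hd : C p ∣ s - Polynomial.aeval f q := by
      rw [← hmapC, map_sub, hqb, hmapae, sub_self]
    obtain ⟨s'', hs''⟩ := hd
    have hDq : D (Polynomial.aeval f q) = 0 := by
      rw [Derivation.map_aeval, hDf, smul_zero]
    apply ih ha s''
    have h1 : D (s - Polynomial.aeval f q) = C p * C a := by
      rw [map_sub, hDq, sub_zero, hs, C_mul]
    rw [hs'', Derivation.leibniz, hC, smul_zero, add_zero, smul_eq_mul] at h1
    exact mul_left_cancel₀ (by simpa using hp.ne_zero) h1
end finalstep

section assembly
open MvPolynomial

/-- `K[x,y,z] ≃ K[x][y,z]`. -/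
def eQ (k : Type) [Field k] :
    MvPolynomial (Fin 3) k ≃ₐ[k] MvPolynomial (Fin 2) (Polynomial k) :=
  (renameEquiv k (finSuccEquiv 2)).trans (optionEquivRight k (Fin 2))

lemma eQ_X0 (k : Type) [Field k] : eQ k (X 0) = C Polynomial.X := by
  simp [eQ]

lemma eQ_aeval (k : Type) [Field k] (r : Polynomial k) :
    eQ k (Polynomial.aeval (X 0) r) = C r := by
  have h : ((eQ k).toAlgHom.comp (Polynomial.aeval (X 0))) =
      IsScalarTower.toAlgHom k (Polynomial k) (MvPolynomial (Fin 2) (Polynomial k)) := by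
    apply Polynomial.algHom_ext
    simp [eQ_X0, algebraMap_eq]
  have := DFunLike.congr_fun h r
  simpa [algebraMap_eq] using this

lemma eQ_symm_C (k : Type) [Field k] (r : Polynomial k) :
    (eQ k).symm (C r) = Polynomial.aeval (X 0) r := by
  rw [← eQ_aeval, AlgEquiv.symm_apply_apply]

lemma der_aeval_zero {k B : Type} [Field k] [CommRing B] [Algebra k B] (E : Derivation k B B)
    {x : B} (hx : E x = 0) (q : Polynomial k) : E (Polynomial.aeval x q) = 0 := by
  rw [Derivation.map_aeval, hx, smul_zero]

lemma transport {k : Type} [Field k]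
    (E : Derivation k (MvPolynomial (Fin 3) k) (MvPolynomial (Fin 3) k)) (h0 : E (X 0) = 0) :
    ∃ D : Derivation (Polynomial k) (MvPolynomial (Fin 2) (Polynomial k))
      (MvPolynomial (Fin 2) (Polynomial k)), ∀ p, D (eQ k p) = eQ k (E p) := by
  refine ⟨Derivation.mk'
    { toFun := fun q => eQ k (E ((eQ k).symm q))
      map_add' := fun a b => by simp only [map_add]
      map_smul' := fun r q => ?_ } ?_, ?_⟩
  · rw [smul_eq_C_mul, map_mul, Derivation.leibniz, eQ_symm_C, der_aeval_zero E h0, smul_zero,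
      add_zero, smul_eq_mul, map_mul, eQ_aeval, RingHom.id_apply, smul_eq_C_mul]
  · intro a b
    simp only [LinearMap.coe_mk, AddHom.coe_mk, map_mul, Derivation.leibniz, smul_eq_mul, map_add,
      AlgEquiv.apply_symm_apply]
  · intro p
    simp only [Derivation.coe_mk', LinearMap.coe_mk, AddHom.coe_mk, AlgEquiv.symm_apply_apply]

lemma isLN_conj {R S A B : Type} [CommRing R] [CommRing S] [CommRing A] [CommRing B]
    [Algebra R A] [Algebra S B] (E : Derivation R A A) (D : Derivation S B B) (e : A ≃+* B)
    (h : ∀ p, D (e p) = e (E p)) (hE : IsLN E) : IsLN D := by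
  intro b
  obtain ⟨n, hn⟩ := hE (e.symm b)
  refine ⟨n, ?_⟩
  have hs : Function.Semiconj e E D := fun p => (h p).symm
  have := (hs.iterate_right n) (e.symm b)
  rw [hn, map_zero, RingEquiv.apply_symm_apply] at this
  exact this.symm

lemma slice_x {k : Type} [Field k] [CharZero k]
    (E : Derivation k (MvPolynomial (Fin 3) k) (MvPolynomial (Fin 3) k)) (h0 : E (X 0) = 0)
    (hE : IsLN E) (hirr : ∀ d, (∀ g, d ∣ E g) → IsUnit d) :
    ∃ s, ∃ a : Polynomial k, a ≠ 0 ∧ E s = Polynomial.aeval (X 0) a := by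
  obtain ⟨D, hD⟩ := transport E h0
  have hDln : IsLN D := isLN_conj E D (eQ k).toRingEquiv hD hE
  obtain ⟨s, a, ha, hs⟩ := local_slice_const D hDln (by
    intro d hd
    have h1 := dvd_der D d hd
    have h2 : IsUnit ((eQ k).symm d) := by
      apply hirr
      intro g
      have := map_dvd (eQ k).symm (h1 (eQ k g))
      rwa [hD, AlgEquiv.symm_apply_apply] at this
    have h3 := h2.map (eQ k)
    rwa [AlgEquiv.apply_symm_apply] at h3)
  refine ⟨(eQ k).symm s, a, ha, ?_⟩
  apply (eQ k).injective
  rw [← hD, AlgEquiv.apply_symm_apply, hs, eQ_aeval]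

lemma slice_x1 {k : Type} [Field k] [CharZero k]
    (E : Derivation k (MvPolynomial (Fin 3) k) (MvPolynomial (Fin 3) k))
    (φ : MvPolynomial (Fin 3) k ≃ₐ[k] MvPolynomial (Fin 3) k) (h0 : E (φ (X 0)) = 0)
    (hE : IsLN E) (hirr : ∀ d, (∀ g, d ∣ E g) → IsUnit d) :
    ∃ s, ∃ a : Polynomial k, a ≠ 0 ∧ E s = Polynomial.aeval (φ (X 0)) a := by
  let E1 : Derivation k (MvPolynomial (Fin 3) k) (MvPolynomial (Fin 3) k) := Derivation.mk'
    { toFun := fun q => φ.symm (E (φ q))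
      map_add' := fun a b => by simp only [map_add]
      map_smul' := fun r q => by
        rw [map_smul, Derivation.map_smul, map_smul, RingHom.id_apply] } (by
      intro a b
      simp only [LinearMap.coe_mk, AddHom.coe_mk, map_mul, Derivation.leibniz, smul_eq_mul, map_add,
        AlgEquiv.symm_apply_apply])
  have hE1 : ∀ q, E1 q = φ.symm (E (φ q)) := fun q => rfl
  obtain ⟨s, a, ha, hs⟩ := slice_x E1 (by rw [hE1, h0, map_zero])
    (isLN_conj E E1 φ.symm.toRingEquiv (fun p => by
      change E1 (φ.symm p) = φ.symm (E p)
      rw [hE1, AlgEquiv.apply_symm_apply]) hE) (by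
      intro d hd
      have h2 : IsUnit (φ d) := by
        apply hirr
        intro g
        have := map_dvd φ (hd (φ.symm g))
        rwa [hE1, AlgEquiv.apply_symm_apply, AlgEquiv.apply_symm_apply] at this
      have h3 := h2.map φ.symm
      rwa [AlgEquiv.symm_apply_apply] at h3)
  refine ⟨φ s, a, ha, ?_⟩
  rw [hE1] at hs
  rw [Polynomial.aeval_algHom_apply, ← hs, AlgEquiv.apply_symm_apply]

lemma slice_theorem {k B : Type} [Field k] [CharZero k] [CommRing B] [Algebra k B]
    (E : Derivation k B B) (hE : IsLN E) (s : B) (hs : E s = 1) (S : Subalgebra k B)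
    (hS : ∀ c, E c = 0 → c ∈ S) (hsS : s ∈ S) : S = ⊤ := by
  let T : Submodule k B := Submodule.span k {b | ∃ c, ∃ n : ℕ, E c = 0 ∧ b = c * s ^ n}
  have hT : ∀ b ∈ T, ∃ b' ∈ T, E b' = b := by
    intro b hb
    induction hb using Submodule.span_induction with
    | mem b hb =>
      obtain ⟨c, n, hc, rfl⟩ := hb
      refine ⟨((n + 1 : k)⁻¹) • (c * s ^ (n + 1)),
        Submodule.smul_mem _ _ (Submodule.subset_span ⟨c, n + 1, hc, rfl⟩), ?_⟩
      have hn : (n + 1 : k) ≠ 0 := by exact_mod_cast Nat.succ_ne_zero n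
      rw [Derivation.map_smul, Derivation.leibniz, hc, smul_zero, add_zero, Derivation.leibniz_pow, hs,
        inv_smul_eq_iff₀ hn, Nat.add_sub_cancel]
      simp only [smul_eq_mul, mul_one, nsmul_eq_mul, Nat.cast_add, Nat.cast_one]
      rw [Algebra.smul_def, map_add, map_one, map_natCast]
      ring
    | zero => exact ⟨0, T.zero_mem, map_zero _⟩
    | add x y _ _ hx hy =>
      obtain ⟨x', hx', rfl⟩ := hx
      obtain ⟨y', hy', rfl⟩ := hy
      exact ⟨x' + y', T.add_mem hx' hy', map_add _ _ _⟩
    | smul r x _ hx =>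
      obtain ⟨x', hx', rfl⟩ := hx
      exact ⟨r • x', T.smul_mem r hx', Derivation.map_smul _ _ _⟩
  have hall : ∀ n a, (⇑E)^[n] a = 0 → a ∈ T := by
    intro n
    induction n with
    | zero => intro a ha; rw [show a = 0 from ha]; exact T.zero_mem
    | succ n ih =>
      intro a ha
      obtain ⟨b, hb, hb'⟩ := hT _ (ih (E a) ha)
      have h1 : a - b ∈ T := Submodule.subset_span ⟨a - b, 0, by rw [map_sub, hb', sub_self],
        by rw [pow_zero, mul_one]⟩
      have := T.add_mem h1 hb
      rwa [sub_add_cancel] at this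
  rw [eq_top_iff]
  intro a _
  obtain ⟨n, hn⟩ := hE a
  have hle : T ≤ Subalgebra.toSubmodule S := by
    rw [Submodule.span_le]
    rintro _ ⟨c, n, hc, rfl⟩
    exact S.mul_mem (hS c hc) (S.pow_mem hsS n)
  exact hle (hall n a hn)

lemma totalDegree_unit {R : Type} [CommRing R] [IsDomain R] {σ : Type} {u : MvPolynomial σ R}
    (hu : IsUnit u) : u.totalDegree = 0 := by
  obtain ⟨v, hv⟩ := hu.exists_right_inv
  have h0 : u * v ≠ 0 := by rw [hv]; exact one_ne_zero
  have := totalDegree_mul_of_isDomain (left_ne_zero_of_mul h0) (right_ne_zero_of_mul h0)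
  rw [hv, totalDegree_one] at this
  omega

lemma not_dvd_aeval {k : Type} [Field k]
    (φ : MvPolynomial (Fin 3) k ≃ₐ[k] MvPolynomial (Fin 3) k)
    (hx : eQ k (φ (X 0)) ∉ Set.range (C (σ := Fin 2) (R := Polynomial k)))
    (p : Polynomial k) (hp : Irreducible p) (b : Polynomial k) (hb : b ≠ 0) :
    ¬ C p ∣ eQ k (φ (Polynomial.aeval (X 0) b)) := by
  have hpp : Prime (C p : MvPolynomial (Fin 2) (Polynomial k)) := (prime_C_iff _).2 hp.prime
  revert hb
  induction b using WfDvdMonoid.induction_on_irreducible with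
  | zero => intro h; exact absurd rfl h
  | unit u hu =>
    intro _ h
    exact hpp.not_isUnit (isUnit_of_dvd_unit h (((hu.map _).map φ).map (eQ k)))
  | mul a ρ ha hρ ih =>
    intro _ h
    rw [map_mul, map_mul, map_mul] at h
    rcases hpp.dvd_or_dvd h with h | h
    · have h1 : Irreducible (eQ k (φ (Polynomial.aeval (X 0) ρ))) := by
        have h2 : Prime (C ρ : MvPolynomial (Fin 2) (Polynomial k)) := (prime_C_iff _).2 hρ.prime
        rw [MulEquiv.irreducible_iff (eQ k), MulEquiv.irreducible_iff φ, ← eQ_symm_C,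
          MulEquiv.irreducible_iff (eQ k).symm]
        exact h2.irreducible
      obtain ⟨g, hg⟩ := h
      have hgu := (h1.isUnit_or_isUnit hg).resolve_left hpp.not_isUnit
      have hdeg : (eQ k (φ (Polynomial.aeval (X 0) ρ))).totalDegree = 0 := by
        rw [hg, totalDegree_mul_of_isDomain hpp.ne_zero hgu.ne_zero, totalDegree_C,
          totalDegree_unit hgu]
      rw [← Polynomial.aeval_algHom_apply, ← Polynomial.aeval_algHom_apply,
        ← Polynomial.aeval_map_algebraMap (Polynomial k), totalDegree_aeval,
        Polynomial.natDegree_map] at hdeg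
      have h3 := hρ.natDegree_pos
      have h4 : (eQ k (φ (X 0))).totalDegree = 0 := by
        rcases Nat.mul_eq_zero.1 hdeg with h | h
        · omega
        · exact h
      rw [totalDegree_eq_zero_iff_eq_C] at h4
      exact hx ⟨_, h4.symm⟩
    · exact ih ha h

lemma main_irr {k : Type} [Field k] [CharZero k]
    (E : Derivation k (MvPolynomial (Fin 3) k) (MvPolynomial (Fin 3) k))
    (φ : MvPolynomial (Fin 3) k ≃ₐ[k] MvPolynomial (Fin 3) k)
    (h0 : E (X 0) = 0) (h1 : E (φ (X 0)) = 0)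
    (hE : IsLN E) (hirr : ∀ d, (∀ g, d ∣ E g) → IsUnit d) :
    (∃ q : Polynomial k, φ (X 0) = Polynomial.aeval (X 0) q) ∨
    ∃ f s, E f = 0 ∧ Algebra.adjoin k {X 0, f, s} = ⊤ := by
  by_cases hx : eQ k (φ (X 0)) ∈ Set.range (C (σ := Fin 2) (R := Polynomial k))
  · left
    obtain ⟨q, hq⟩ := hx
    refine ⟨q, ?_⟩
    rw [← eQ_symm_C, hq, AlgEquiv.symm_apply_apply]
  right
  obtain ⟨D, hD⟩ := transport E h0
  have hDln : IsLN D := isLN_conj E D (eQ k).toRingEquiv hD hE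
  have hD0 : D ≠ 0 := by
    rintro rfl
    apply not_isUnit_zero (hirr 0 _)
    intro g
    rw [zero_dvd_iff]
    apply (eQ k).injective
    rw [← hD, map_zero, Derivation.zero_apply]
  obtain ⟨f, hf, hfc, hDf, hker⟩ := kernel_gen D hD0 hDln (eQ k (φ (X 0)))
    (by rw [hD, h1, map_zero]) hx
  obtain ⟨s, a, ha, hs⟩ := slice_x E h0 hE hirr
  obtain ⟨s1, b, hb, hs1⟩ := slice_x1 E φ h1 hE hirr
  obtain ⟨s', hs'⟩ := slice_of_coprime D f hf hfc hDf hker (eQ k s1)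
    (eQ k (Polynomial.aeval (φ (X 0)) b)) (by rw [hD, hs1])
    (by rw [hD, der_aeval_zero E h1, map_zero]) (by
      intro p hp
      have := not_dvd_aeval φ hx p hp b hb
      rwa [← Polynomial.aeval_algHom_apply] at this) a ha (eQ k s) (by rw [hD, hs, eQ_aeval])
  have hEs : ∀ q, E ((eQ k).symm q) = (eQ k).symm (D q) := by
    intro q
    apply (eQ k).injective
    rw [← hD, AlgEquiv.apply_symm_apply, AlgEquiv.apply_symm_apply]
  refine ⟨(eQ k).symm f, (eQ k).symm s', by rw [hEs, hDf, map_zero], ?_⟩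
  apply slice_theorem E hE ((eQ k).symm s') (by rw [hEs, hs', map_one])
  · intro c hc
    obtain ⟨q, hq⟩ := hker (eQ k c) (by rw [hD, hc, map_zero])
    have hc' : c = (eQ k).symm (Polynomial.aeval f q) := by
      rw [← hq, AlgEquiv.symm_apply_apply]
    rw [hc']
    clear hc' hq
    induction q using Polynomial.induction_on' with
    | add p q hp hq => rw [map_add, map_add]; exact add_mem hp hq
    | monomial n r =>
      rw [Polynomial.aeval_monomial, map_mul, map_pow, algebraMap_eq, eQ_symm_C]
      apply mul_mem
      · exact Algebra.adjoin_mono (by simp) (Polynomial.aeval_mem_adjoin_singleton k (X 0))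
      · exact pow_mem (Algebra.subset_adjoin (by simp)) n
  · exact Algebra.subset_adjoin (by simp)

lemma exists_irr {k : Type} [Field k] [CharZero k]
    (E : Derivation k (MvPolynomial (Fin 3) k) (MvPolynomial (Fin 3) k)) (hE0 : E ≠ 0) :
    ∃ c : MvPolynomial (Fin 3) k, ∃ D : Derivation k (MvPolynomial (Fin 3) k) (MvPolynomial (Fin 3) k),
      E = c • D ∧ c ≠ 0 ∧ ∀ d, (∀ g, d ∣ D g) → IsUnit d := by
  classical
  obtain ⟨inst⟩ : Nonempty (NormalizedGCDMonoid (MvPolynomial (Fin 3) k)) := inferInstance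
  obtain ⟨g, hg, hg1⟩ := Finset.extract_gcd (s := (Finset.univ : Finset (Fin 3)))
    (fun i => E (X i)) Finset.univ_nonempty
  have hEq : E = (Finset.univ.gcd fun i => E (X i)) • mkDerivation k g := by
    apply MvPolynomial.derivation_ext
    intro i
    rw [Derivation.smul_apply, mkDerivation_X, smul_eq_mul]
    exact hg i (Finset.mem_univ i)
  refine ⟨_, mkDerivation k g, hEq, ?_, ?_⟩
  · intro h
    rw [h, zero_smul] at hEq
    exact hE0 hEq
  · intro d hd
    have : d ∣ Finset.univ.gcd g := Finset.dvd_gcd fun i _ => by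
      have := hd (X i)
      rwa [mkDerivation_X] at this
    rw [hg1] at this
    exact isUnit_of_dvd_one this

lemma exists_aut {k : Type} [Field k] (x y z : MvPolynomial (Fin 3) k)
    (h : Algebra.adjoin k {x, y, z} = ⊤) :
    ∃ φ : MvPolynomial (Fin 3) k ≃ₐ[k] MvPolynomial (Fin 3) k, φ (X 0) = x := by
  let ψ : MvPolynomial (Fin 3) k →ₐ[k] MvPolynomial (Fin 3) k := aeval ![x, y, z]
  have hs : Function.Surjective ψ := by
    rw [← AlgHom.range_eq_top, eq_top_iff, ← h, Algebra.adjoin_le_iff]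
    rintro a (rfl | rfl | rfl)
    · exact ⟨X 0, by simp [ψ]⟩
    · exact ⟨X 1, by simp [ψ]⟩
    · exact ⟨X 2, by simp [ψ]⟩
  have hi : Function.Injective ψ := by
    let ker : ℕ →o Ideal (MvPolynomial (Fin 3) k) :=
      { toFun := fun n => RingHom.ker (ψ ^ n)
        monotone' := by
          apply monotone_nat_of_le_succ
          intro n a ha
          rw [RingHom.mem_ker] at ha ⊢
          rw [pow_succ', AlgHom.mul_apply, ha, map_zero] }
    obtain ⟨n, hn⟩ := monotone_stabilizes_iff_noetherian.2
      (inferInstance : IsNoetherian (MvPolynomial (Fin 3) k) (MvPolynomial (Fin 3) k)) ker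
    have hsn : Function.Surjective (ψ ^ n) := by
      rw [AlgHom.coe_pow]
      exact hs.iterate n
    rw [injective_iff_map_eq_zero]
    intro a ha
    obtain ⟨b, rfl⟩ := hsn a
    have h1 : b ∈ ker (n + 1) := by
      change b ∈ RingHom.ker (ψ ^ (n + 1))
      rw [RingHom.mem_ker, pow_succ', AlgHom.mul_apply, ha]
    rw [← hn (n + 1) (Nat.le_succ n)] at h1
    exact h1
  exact ⟨AlgEquiv.ofBijective ψ ⟨hi, hs⟩, by simp [ψ]⟩

lemma rank_ne_two {k : Type} [Field k] [CharZero k] (E : Derivation k (PolyR k) (PolyR k))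
    (u v w : PolyR k) (h : Algebra.adjoin k {u, v, w} = ⊤) (hu : E u = 0) (hv : E v = 0) :
    rankD k E ≠ 2 := by
  have h2 : 2 ≤ corank k E := by
    unfold corank
    apply le_csSup
    · refine ⟨3, ?_⟩
      rintro r ⟨l, rfl, _, m, hm, _⟩
      rw [List.length_append] at hm
      omega
    · refine ⟨[u, v], rfl, ?_, [w], rfl, ?_⟩
      · intro f hf
        simp only [List.mem_cons, List.not_mem_nil, or_false] at hf
        rcases hf with rfl | rfl
        · exact hu
        · exact hv
      · rw [← h]
        congr 1
        ext a
        simp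
  unfold rankD
  omega

lemma adjoin_eq {k : Type} [Field k] (x1 : MvPolynomial (Fin 3) k)
    (φ : MvPolynomial (Fin 3) k ≃ₐ[k] MvPolynomial (Fin 3) k) (hφ : φ (X 0) = x1)
    (q : Polynomial k) (hq : x1 = Polynomial.aeval (X 0) q) :
    Algebra.adjoin k {(X 0 : MvPolynomial (Fin 3) k)} = Algebra.adjoin k {x1} := by
  have h1 : (X 0 : MvPolynomial (Fin 3) k) = Polynomial.aeval (φ.symm (X 0)) q := by
    rw [Polynomial.aeval_algHom_apply, ← hq, ← hφ, AlgEquiv.symm_apply_apply]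
  have h2 := congrArg totalDegree h1
  rw [totalDegree_X, totalDegree_aeval] at h2
  have h3 : q.natDegree = 1 := Nat.eq_one_of_mul_eq_one_right h2.symm
  obtain ⟨a, ha, b, rfl⟩ := Polynomial.natDegree_eq_one.1 h3
  rw [map_add, map_mul, Polynomial.aeval_C, Polynomial.aeval_C, Polynomial.aeval_X] at hq
  apply le_antisymm
  · rw [Algebra.adjoin_le_iff, Set.singleton_subset_iff]
    have h4 : (X 0 : MvPolynomial (Fin 3) k) =
        a⁻¹ • (x1 - algebraMap k (MvPolynomial (Fin 3) k) b) := by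
      rw [hq, add_sub_cancel_right, ← Algebra.smul_def, smul_smul, inv_mul_cancel₀ ha, one_smul]
    rw [h4]
    exact Subalgebra.smul_mem _ (sub_mem (Algebra.self_mem_adjoin_singleton _ _)
      (Subalgebra.algebraMap_mem _ _)) _
  · rw [Algebra.adjoin_le_iff, Set.singleton_subset_iff, hq]
    exact add_mem (mul_mem (Subalgebra.algebraMap_mem _ _) (Algebra.self_mem_adjoin_singleton _ _))
      (Subalgebra.algebraMap_mem _ _)
end assembly

/-- For a rank-two locally nilpotent derivation with `X x = 0`, any coordinate system
`x₁,y₁,z₁` with `X x₁ = 0` satisfies `K[x] = K[x₁]`. -/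
theorem kernel_coordinate_unique {K : Type} [Field K] [CharZero K]
    (X : Derivation K (PolyR K) (PolyR K))
    (hln : LND K X) (hrk : rankD K X = 2)
    (hXx : X (MvPolynomial.X 0) = 0)
    (x1 y1 z1 : PolyR K) (hsys : IsCoordSys K x1 y1 z1) (hXx1 : X x1 = 0) :
    Algebra.adjoin K {(MvPolynomial.X 0 : PolyR K)} = Algebra.adjoin K {x1} := by
  have hX0 : X ≠ 0 := by
    rintro rfl
    exact rank_ne_two _ x1 y1 z1 hsys rfl rfl hrk
  have hXln : IsLN X := fun a => by
    obtain ⟨n, _, hn⟩ := hln a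
    exact ⟨n, hn⟩
  obtain ⟨c, E, rfl, hc, hirr⟩ := exists_irr X hX0
  have hE : IsLN E := isLN_of_smul E c hX0 hXln
  have hker : ∀ g, (c • E) g = 0 → E g = 0 := by
    intro g hg
    rw [Derivation.smul_apply, smul_eq_mul] at hg
    exact (mul_eq_zero.1 hg).resolve_left hc
  obtain ⟨φ, hφ⟩ := exists_aut x1 y1 z1 hsys
  rcases main_irr E φ (hker _ hXx) (by rw [hφ]; exact hker _ hXx1) hE hirr with
    ⟨q, hq⟩ | ⟨f, s, hf, hadj⟩
  · exact adjoin_eq x1 φ hφ q (by rw [← hφ, hq])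
  · exact absurd hrk (rank_ne_two _ _ f s hadj hXx
      (by rw [Derivation.smul_apply, hf, smul_zero]))

end
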